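/- Let G(t,x) be the heat kernel on ℝ (vanishing for t ≤ 0) and G' = ∂_x G, with F̃(t,x) := F(-t,-x). Then 2 (G' * G̃')(t,x) = G(t,x) + G̃(t,x) for all (t,x) ≠ (0,0), where * denotes space-time convolution. -/

import Mathlib

open MeasureTheory Real

/-- The 1d heat kernel, extended by zero for nonpositive times. -/
noncomputable def heatK (t x : ℝ) : ℝ :=
  if 0 < t then (Real.sqrt (4 * Real.pi * t))⁻¹ * Real.exp (-x ^ 2 / (4 * t)) else 0

/-- Space-time convolution `(F * H)(t,x) = ∫∫ F(t-s, x-y) H(s,y) dy ds`. -/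
noncomputable def stConv (F H : ℝ → ℝ → ℝ) : ℝ → ℝ → ℝ :=
  fun t x => ∫ p : ℝ × ℝ, F (t - p.1) (x - p.2) * H p.1 p.2

theorem deriv_heatK (s y : ℝ) :
    deriv (fun z => heatK s z) y = -(y / (2 * s)) * heatK s y := by
  unfold heatK
  split_ifs with hs
  · have h1 : HasDerivAt (fun z : ℝ => -z ^ 2 / (4 * s)) (-(y / (2 * s))) y := by
      refine (((hasDerivAt_pow 2 y).neg).div_const (4 * s)).congr_deriv ?_
      field_simp
      norm_num
      ring
    rw [(h1.exp.const_mul _).deriv]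
    ring
  · simp

theorem measurable_heatK : Measurable fun p : ℝ × ℝ => heatK p.1 p.2 := by
  unfold heatK
  refine Measurable.ite (measurableSet_lt measurable_const measurable_fst) ?_ measurable_const
  fun_prop

/-- The spatial derivative of the heat kernel. -/
noncomputable def heatK' (s y : ℝ) : ℝ := -(y / (2 * s)) * heatK s y

theorem measurable_heatK' : Measurable fun p : ℝ × ℝ => heatK' p.1 p.2 := by
  unfold heatK'
  have := measurable_heatK
  fun_prop

theorem heatK'_of_nonpos {s : ℝ} (hs : s ≤ 0) (y : ℝ) : heatK' s y = 0 := by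
  simp [heatK', heatK, not_lt.2 hs]

theorem abs_heatK'_le {a : ℝ} (ha : 0 < a) (z : ℝ) :
    |heatK' a z| ≤ a⁻¹ * exp (-(z ^ 2 / (8 * a))) := by
  have hsq : 0 < √(4 * π * a) := by positivity
  have key : |z| ≤ 2 * √(4 * π * a) * exp (z ^ 2 / (8 * a)) := by
    apply abs_le_of_sq_le_sq _ (by positivity)
    rw [mul_pow, mul_pow, sq_sqrt (by positivity), ← exp_nat_mul]
    have h1 := add_one_le_exp ((2 : ℕ) * (z ^ 2 / (8 * a)))
    have h2 : z ^ 2 / (4 * a) ≤ exp ((2 : ℕ) * (z ^ 2 / (8 * a))) := by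
      refine le_trans ?_ h1
      have : ((2 : ℕ) : ℝ) * (z ^ 2 / (8 * a)) = z ^ 2 / (4 * a) := by
        push_cast; field_simp; ring
      linarith
    calc z ^ 2 ≤ (4 * π) * z ^ 2 := by nlinarith [pi_gt_three, sq_nonneg z]
      _ = 2 ^ 2 * (4 * π * a) * (z ^ 2 / (4 * a)) := by field_simp; ring
      _ ≤ _ := by gcongr
  have e : exp (-z ^ 2 / (4 * a)) = exp (-(z ^ 2 / (8 * a))) * exp (-(z ^ 2 / (8 * a))) := by
    rw [← exp_add]; congr 1; field_simp; norm_num; ring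
  have e' : exp (z ^ 2 / (8 * a)) * exp (-(z ^ 2 / (8 * a))) = 1 := by
    rw [← exp_add]; simp
  rw [heatK', heatK, if_pos ha, abs_mul, abs_neg, abs_div,
    abs_of_pos (by positivity : 0 < 2 * a),
    abs_of_pos (by positivity : 0 < (√(4 * π * a))⁻¹ * exp (-z ^ 2 / (4 * a))), e]
  calc _ = |z| / (2 * a) * (√(4 * π * a))⁻¹ * exp (-(z ^ 2 / (8 * a)))
          * exp (-(z ^ 2 / (8 * a))) := by ring
    _ ≤ (2 * √(4 * π * a) * exp (z ^ 2 / (8 * a))) / (2 * a) * (√(4 * π * a))⁻¹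
          * exp (-(z ^ 2 / (8 * a))) * exp (-(z ^ 2 / (8 * a))) := by gcongr
    _ = a⁻¹ * (exp (z ^ 2 / (8 * a)) * exp (-(z ^ 2 / (8 * a))))
          * exp (-(z ^ 2 / (8 * a))) := by field_simp
    _ = _ := by rw [e', mul_one]

theorem exists_heatK'_mul_bound {t x : ℝ} (ht : 0 ≤ t) (h : (t, x) ≠ (0, 0)) :
    ∃ c : ℝ, 0 < c ∧ ∀ r y : ℝ, 0 < r →
      |heatK' (t + r) (x + y) * heatK' r y| ≤
        (r + c)⁻¹ * (r⁻¹ * exp (-(16 * r)⁻¹ * y ^ 2)) := by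
  rcases ht.eq_or_lt with rfl | ht
  · have hx : x ≠ 0 := by rintro rfl; exact h rfl
    refine ⟨x ^ 2 / 32, by positivity, fun r y hr => ?_⟩
    have hb : exp (-(x ^ 2 / 32 / r)) ≤ r * (r + x ^ 2 / 32)⁻¹ := by
      rw [exp_neg, ← div_eq_mul_inv, ← inv_div (r + x ^ 2 / 32) r]
      apply inv_anti₀ (by positivity)
      have := add_one_le_exp (x ^ 2 / 32 / r)
      rw [add_div, div_self hr.ne']
      linarith
    rw [abs_mul, zero_add]
    calc _ ≤ (r⁻¹ * exp (-((x + y) ^ 2 / (8 * r)))) * (r⁻¹ * exp (-(y ^ 2 / (8 * r)))) := by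
          gcongr
          · exact abs_heatK'_le hr _
          · exact abs_heatK'_le hr _
      _ = r⁻¹ * r⁻¹ * exp (-((x + y) ^ 2 / (8 * r)) + -(y ^ 2 / (8 * r))) := by
          rw [exp_add]; ring
      _ ≤ r⁻¹ * r⁻¹ * exp (-(x ^ 2 / 32 / r) + -(16 * r)⁻¹ * y ^ 2) := by
          refine mul_le_mul_of_nonneg_left (exp_le_exp.2 ?_) (by positivity)
          have : -(x ^ 2 / 32 / r) + -(16 * r)⁻¹ * y ^ 2
              - (-((x + y) ^ 2 / (8 * r)) + -(y ^ 2 / (8 * r)))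
              = (32 * r)⁻¹ * (4 * (x + y) ^ 2 + 4 * y ^ 2 - x ^ 2 - 2 * y ^ 2) := by
            field_simp; ring
          have h2 : 0 ≤ (32 * r)⁻¹ * (4 * (x + y) ^ 2 + 4 * y ^ 2 - x ^ 2 - 2 * y ^ 2) := by
            apply mul_nonneg (by positivity)
            nlinarith [sq_nonneg (3 * x + 4 * y), sq_nonneg y]
          linarith
      _ = r⁻¹ * r⁻¹ * exp (-(x ^ 2 / 32 / r)) * exp (-(16 * r)⁻¹ * y ^ 2) := by
          rw [exp_add]; ring
      _ ≤ r⁻¹ * r⁻¹ * (r * (r + x ^ 2 / 32)⁻¹) * exp (-(16 * r)⁻¹ * y ^ 2) := by gcongr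
      _ = _ := by field_simp
  · refine ⟨t, ht, fun r y hr => ?_⟩
    rw [abs_mul]
    have h1 : |heatK' (t + r) (x + y)| ≤ (r + t)⁻¹ := by
      refine (abs_heatK'_le (by positivity) _).trans ?_
      rw [add_comm t r]
      apply mul_le_of_le_one_right (by positivity)
      rw [exp_le_one_iff]
      have : 0 ≤ (x + y) ^ 2 / (8 * (r + t)) := by positivity
      linarith
    gcongr
    refine (abs_heatK'_le hr _).trans ?_
    gcongr
    have : -(16 * r)⁻¹ * y ^ 2 - (-(y ^ 2 / (8 * r))) = y ^ 2 / (16 * r) := by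
      field_simp; norm_num
    have : 0 ≤ y ^ 2 / (16 * r) := by positivity
    linarith

theorem integral_quadratic_mul_gaussian {b : ℝ} (hb : 0 < b) (l k : ℝ) :
    ∫ z : ℝ, (z ^ 2 + l * z - k) * exp (-b * z ^ 2) = ((2 * b)⁻¹ - k) * √(π / b) := by
  have i0 := integrable_exp_neg_mul_sq hb
  have i1 := integrable_mul_exp_neg_mul_sq hb
  have i2 : Integrable fun z : ℝ => z ^ 2 * exp (-b * z ^ 2) := by
    simpa using integrable_rpow_mul_exp_neg_mul_sq hb (s := 2) (by norm_num)
  have i3 : Integrable fun z : ℝ => (-(2 * b)⁻¹ + z ^ 2 + l * z) * exp (-b * z ^ 2) := by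
    refine (((i0.const_mul (-(2 * b)⁻¹)).add i2).add (i1.const_mul l)).congr ?_
    filter_upwards with z
    simp only [Pi.add_apply]
    ring
  have i4 : Integrable fun z : ℝ => -((2 * b)⁻¹ * (z + l)) * exp (-b * z ^ 2) := by
    refine ((i1.const_mul (-(2 * b)⁻¹)).add (i0.const_mul (-(2 * b)⁻¹ * l))).congr ?_
    filter_upwards with z
    simp only [Pi.add_apply]
    ring
  have hd : ∀ z : ℝ, HasDerivAt (fun z : ℝ => -((2 * b)⁻¹ * (z + l)) * exp (-b * z ^ 2))
      ((-(2 * b)⁻¹ + z ^ 2 + l * z) * exp (-b * z ^ 2)) z := by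
    intro z
    have h1 : HasDerivAt (fun z : ℝ => -b * z ^ 2) (-b * (2 * z)) z := by
      simpa using (hasDerivAt_pow 2 z).const_mul (-b)
    have h2 : HasDerivAt (fun z : ℝ => -((2 * b)⁻¹ * (z + l))) (-((2 * b)⁻¹ * 1)) z :=
      (((hasDerivAt_id z).add_const l).const_mul _).neg
    refine (h2.mul h1.exp).congr_deriv ?_
    field_simp
    ring
  have h0 := integral_eq_zero_of_hasDerivAt_of_integrable hd i3 i4
  calc _ = ∫ z : ℝ, ((-(2 * b)⁻¹ + z ^ 2 + l * z) * exp (-b * z ^ 2)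
            + ((2 * b)⁻¹ - k) * exp (-b * z ^ 2)) := by
        congr 1; ext z; ring
    _ = _ := by
        rw [integral_add i3 (i0.const_mul _), h0, integral_const_mul, integral_gaussian, zero_add]

theorem integral_heatK'_mul_heatK' {a b : ℝ} (ha : 0 < a) (hb : 0 < b) (x : ℝ) :
    ∫ y, heatK' a (x + y) * heatK' b y =
      ((2 * (a + b))⁻¹ - x ^ 2 / (4 * (a + b) ^ 2)) * heatK (a + b) x := by
  have hab : 0 < a + b := by positivity
  rw [← integral_sub_right_eq_self _ (b * x / (a + b))]
  set C := (4 * a * b)⁻¹ * ((√(4 * π * a))⁻¹ * (√(4 * π * b))⁻¹) * exp (-x ^ 2 / (4 * (a + b)))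
    with hC
  have e : ∀ z, heatK' a (x + (z - b * x / (a + b))) * heatK' b (z - b * x / (a + b)) =
      C * ((z ^ 2 + ((a - b) * x / (a + b)) * z - a * b * x ^ 2 / (a + b) ^ 2) *
        exp (-((a + b) / (4 * a * b)) * z ^ 2)) := by
    intro z
    have e1 : exp (-(x + (z - b * x / (a + b))) ^ 2 / (4 * a)) *
        exp (-(z - b * x / (a + b)) ^ 2 / (4 * b)) = exp (-x ^ 2 / (4 * (a + b))) *
          exp (-((a + b) / (4 * a * b)) * z ^ 2) := by
      rw [← exp_add, ← exp_add]
      congr 1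
      field_simp
      ring
    have e2 : (x + (z - b * x / (a + b))) * (z - b * x / (a + b)) =
        z ^ 2 + ((a - b) * x / (a + b)) * z - a * b * x ^ 2 / (a + b) ^ 2 := by
      field_simp
      ring
    rw [← e2, heatK', heatK', heatK, heatK, if_pos ha, if_pos hb]
    calc _ = ((4 * a * b)⁻¹ * ((√(4 * π * a))⁻¹ * (√(4 * π * b))⁻¹)) *
          ((x + (z - b * x / (a + b))) * (z - b * x / (a + b))) *
          (exp (-(x + (z - b * x / (a + b))) ^ 2 / (4 * a)) *
        exp (-(z - b * x / (a + b)) ^ 2 / (4 * b))) := by ring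
      _ = _ := by rw [e1, hC]; ring
  simp_rw [e]
  rw [integral_const_mul, integral_quadratic_mul_gaussian (by positivity), heatK, if_pos hab, hC]
  have e3 : √(π / ((a + b) / (4 * a * b))) =
      √(4 * π * a) * √(4 * π * b) * (√(4 * π * (a + b)))⁻¹ := by
    rw [← sqrt_mul (by positivity), ← sqrt_inv, ← sqrt_mul (by positivity)]
    congr 1
    field_simp
  rw [e3]
  have ha' : √(4 * π * a) ≠ 0 := by positivity
  have hb' : √(4 * π * b) ≠ 0 := by positivity
  have hab' : √(4 * π * (a + b)) ≠ 0 := by positivity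
  field_simp

theorem hasDerivAt_heatK_time {s : ℝ} (hs : 0 < s) (x : ℝ) :
    HasDerivAt (fun s => heatK s x) (-(((2 * s)⁻¹ - x ^ 2 / (4 * s ^ 2)) * heatK s x)) s := by
  have h1 : HasDerivAt (fun s : ℝ => 4 * π * s) (4 * π) s := by
    simpa using (hasDerivAt_id s).const_mul (4 * π)
  have h2 : HasDerivAt (fun s : ℝ => 4 * s) 4 s := by
    simpa using (hasDerivAt_id s).const_mul 4
  have hsq : √(4 * π * s) ≠ 0 := by positivity
  have h3 := (h1.sqrt (by positivity)).inv hsq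
  have h4 := ((hasDerivAt_const s (-x ^ 2)).div h2 (by positivity)).exp
  refine ((h3.mul h4).congr_of_eventuallyEq ?_).congr_deriv ?_
  · filter_upwards [lt_mem_nhds hs] with u hu
    simp [heatK, hu]
  rw [heatK, if_pos hs, sq_sqrt (by positivity)]
  field_simp
  simp only [Pi.div_apply, Pi.inv_apply]
  field_simp
  ring

theorem heatK_nonneg (s x : ℝ) : 0 ≤ heatK s x := by
  unfold heatK
  split_ifs <;> positivity

theorem tendsto_heatK_atTop (x : ℝ) :
    Filter.Tendsto (fun s => heatK s x) Filter.atTop (nhds 0) := by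
  have h : Filter.Tendsto (fun s : ℝ => (√(4 * π * s))⁻¹) Filter.atTop (nhds 0) :=
    (tendsto_sqrt_atTop.comp
      (Filter.tendsto_id.const_mul_atTop (by positivity : 0 < 4 * π))).inv_tendsto_atTop
  refine squeeze_zero' (Filter.Eventually.of_forall fun s => heatK_nonneg s x) ?_ h
  filter_upwards [Filter.eventually_gt_atTop 0] with s hs
  rw [heatK, if_pos hs]
  apply mul_le_of_le_one_right (by positivity)
  rw [exp_le_one_iff, neg_div]
  have : 0 ≤ x ^ 2 / (4 * s) := by positivity
  linarith

theorem heatK_le {x : ℝ} (hx : x ≠ 0) (s : ℝ) : heatK s x ≤ √(4 * π * s) / (π * x ^ 2) := by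
  rcases le_or_gt s 0 with hs | hs
  · rw [heatK, if_neg hs.not_gt]
    positivity
  · rw [heatK, if_pos hs]
    have hb : exp (-x ^ 2 / (4 * s)) ≤ (x ^ 2 / (4 * s))⁻¹ := by
      rw [neg_div, exp_neg]
      apply inv_anti₀ (by positivity)
      have := add_one_le_exp (x ^ 2 / (4 * s))
      linarith
    have h2 : √(4 * π * s) * √(4 * π * s) = 4 * π * s := mul_self_sqrt (by positivity)
    calc _ ≤ (√(4 * π * s))⁻¹ * (x ^ 2 / (4 * s))⁻¹ := by gcongr
      _ = (√(4 * π * s))⁻¹ * (4 * π * s) / (π * x ^ 2) := by field_simp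
      _ = (√(4 * π * s))⁻¹ * (√(4 * π * s) * √(4 * π * s)) / (π * x ^ 2) := by rw [h2]
      _ = _ := by field_simp

theorem continuousAt_heatK_zero {x : ℝ} (hx : x ≠ 0) :
    ContinuousAt (fun s => heatK s x) 0 := by
  have h0 : heatK 0 x = 0 := by simp [heatK]
  rw [ContinuousAt, h0]
  refine squeeze_zero (fun s => heatK_nonneg s x) (heatK_le hx) ?_
  have : Continuous fun s : ℝ => √(4 * π * s) / (π * x ^ 2) := by fun_prop
  simpa using this.tendsto 0

theorem integrableOn_inv_add_mul_inv_sqrt {c : ℝ} (hc : 0 < c) :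
    IntegrableOn (fun r : ℝ => (r + c)⁻¹ * (√r)⁻¹) (Set.Ioi 0) := by
  have hd : ∀ r ∈ Set.Ioi (0 : ℝ), HasDerivAt (fun r => 2 * (√c)⁻¹ * arctan (√r / √c))
      ((r + c)⁻¹ * (√r)⁻¹) r := by
    intro r hr
    have hr : 0 < r := hr
    refine ((((hasDerivAt_sqrt hr.ne').div_const (√c)).arctan).const_mul _).congr_deriv ?_
    have h1 : √c ^ 2 = c := sq_sqrt hc.le
    have h2 : √r ^ 2 = r := sq_sqrt hr.le
    have h3 : √c ≠ 0 := by positivity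
    have h4 : √r ≠ 0 := by positivity
    rw [div_pow, h1, h2]
    field_simp
    rw [h1]
    ring
  refine integrableOn_Ioi_deriv_of_nonneg (l := 2 * (√c)⁻¹ * (π / 2)) ?_ hd ?_ ?_
  · exact Continuous.continuousWithinAt (by fun_prop)
  · intro r hr
    have hr : 0 < r := hr
    positivity
  · refine Filter.Tendsto.const_mul _ ?_
    refine (tendsto_nhds_of_tendsto_nhdsWithin tendsto_arctan_atTop).comp ?_
    exact tendsto_sqrt_atTop.atTop_div_const (by positivity)

theorem integrable_heatK'_mul_heatK' {t x : ℝ} (ht : 0 ≤ t) (h : (t, x) ≠ (0, 0)) :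
    Integrable fun p : ℝ × ℝ => heatK' (t + p.1) (x + p.2) * heatK' p.1 p.2 := by
  obtain ⟨c, hc, hb⟩ := exists_heatK'_mul_bound ht h
  have hm : Measurable fun p : ℝ × ℝ => heatK' (t + p.1) (x + p.2) * heatK' p.1 p.2 :=
    (measurable_heatK'.comp
      (by fun_prop : Measurable fun p : ℝ × ℝ => (t + p.1, x + p.2))).mul measurable_heatK'
  set φ : ℝ × ℝ → ℝ := (Set.Ioi 0 ×ˢ Set.univ).indicator
    fun p => (p.1 + c)⁻¹ * (p.1⁻¹ * exp (-(16 * p.1)⁻¹ * p.2 ^ 2)) with hφ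
  have hφm : Measurable φ :=
    Measurable.indicator (by fun_prop) (measurableSet_Ioi.prod MeasurableSet.univ)
  have hφ0 : ∀ r ≤ 0, ∀ y, φ (r, y) = 0 := by
    intro r hr y
    simp [hφ, hr.not_gt]
  have hφ1 : ∀ r, 0 < r → ∀ y,
      φ (r, y) = (r + c)⁻¹ * (r⁻¹ * exp (-(16 * r)⁻¹ * y ^ 2)) := by
    intro r hr y
    simp [hφ, hr]
  refine Integrable.mono' (g := φ) ?_ hm.aestronglyMeasurable ?_
  · rw [Measure.volume_eq_prod, integrable_prod_iff hφm.aestronglyMeasurable]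
    constructor
    · filter_upwards with r
      rcases le_or_gt r 0 with hr | hr
      · simp [hφ0 r hr]
      · simp only [hφ1 r hr]
        exact ((integrable_exp_neg_mul_sq (by positivity)).const_mul _).const_mul _
    · have e : (fun r => ∫ y, ‖φ (r, y)‖) = (Set.Ioi 0).indicator
          fun r => √(16 * π) * ((r + c)⁻¹ * (√r)⁻¹) := by
        ext r
        rcases le_or_gt r 0 with hr | hr
        · simp [hφ0 r hr, hr.not_gt]
        · rw [Set.indicator_of_mem (by exact hr)]
          have : ∀ y, ‖φ (r, y)‖ = (r + c)⁻¹ * (r⁻¹ * exp (-(16 * r)⁻¹ * y ^ 2)) := by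
            intro y
            rw [hφ1 r hr, norm_of_nonneg (by positivity)]
          simp_rw [this]
          rw [integral_const_mul, integral_const_mul, integral_gaussian, div_inv_eq_mul,
            show π * (16 * r) = 16 * π * r by ring, sqrt_mul (by positivity)]
          have h2 : √r * √r = r := mul_self_sqrt hr.le
          have h3 : r⁻¹ * √r = (√r)⁻¹ := by
            nth_rewrite 1 [← h2]
            field_simp
          rw [← h3]
          ring
      rw [e, integrable_indicator_iff measurableSet_Ioi]
      exact (integrableOn_inv_add_mul_inv_sqrt hc).const_mul _
  · filter_upwards with ⟨r, y⟩
    rcases le_or_gt r 0 with hr | hr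
    · simp [hφ0 r hr, heatK'_of_nonpos hr]
    · rw [hφ1 r hr]
      exact hb r y hr

theorem two_mul_integral_heatK'_mul_heatK' {t x : ℝ} (ht : 0 ≤ t) (h : (t, x) ≠ (0, 0)) :
    2 * ∫ p : ℝ × ℝ, heatK' (t + p.1) (x + p.2) * heatK' p.1 p.2 = heatK t x := by
  have hi := integrable_heatK'_mul_heatK' ht h
  rw [Measure.volume_eq_prod] at hi ⊢
  have hi1 := hi.integral_prod_left
  rw [integral_prod _ hi]
  rw [← setIntegral_eq_integral_of_forall_compl_eq_zero (s := Set.Ioi 0)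
    (fun r hr => by simp [heatK'_of_nonpos (not_lt.1 hr)])]
  have hd : ∀ r ∈ Set.Ioi (0 : ℝ), HasDerivAt (fun r => -(2⁻¹ * heatK (t + 2 * r) x))
      (∫ y, heatK' (t + r) (x + y) * heatK' r y) r := by
    intro r hr
    have hr : 0 < r := hr
    have h1 : HasDerivAt (fun r : ℝ => t + 2 * r) 2 r := by
      simpa using ((hasDerivAt_id r).const_mul 2).const_add t
    have h2 := hasDerivAt_heatK_time (s := t + 2 * r) (by positivity) x
    refine ((h2.comp r h1).const_mul 2⁻¹).neg.congr_deriv ?_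
    rw [integral_heatK'_mul_heatK' (by positivity) hr, show t + r + r = t + 2 * r by ring]
    ring
  rw [integral_Ioi_of_hasDerivAt_of_tendsto (m := 0) _ hd hi1.integrableOn]
  · simp
  · have hl : Filter.Tendsto (fun r : ℝ => t + 2 * r) Filter.atTop Filter.atTop :=
      Filter.tendsto_atTop_add_const_left _ _
        (Filter.tendsto_id.const_mul_atTop (by norm_num))
    simpa using (((tendsto_heatK_atTop x).comp hl).const_mul 2⁻¹).neg
  · have hc : ContinuousAt (fun s => heatK s x) (t + 2 * 0) := by
      rw [mul_zero, add_zero]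
      rcases ht.eq_or_lt with rfl | ht
      · exact continuousAt_heatK_zero (by rintro rfl; exact h rfl)
      · exact (hasDerivAt_heatK_time ht x).continuousAt
    have hc2 : ContinuousAt (fun r : ℝ => heatK (t + 2 * r) x) 0 :=
      ContinuousAt.comp (f := fun r : ℝ => t + 2 * r) hc (by fun_prop)
    exact (hc2.const_mul 2⁻¹).neg.continuousWithinAt

theorem heatK_neg (s x : ℝ) : heatK s (-x) = heatK s x := by
  simp [heatK]

/-- `2 (G' * G̃')(t,x) = G(t,x) + G̃(t,x)` away from the origin, where
`G'` is the spatial derivative of the heat kernel and tilde denotes reflection. -/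
theorem stmt_5 (t x : ℝ) (h : (t, x) ≠ (0, 0)) :
    2 * stConv (fun s y => deriv (fun z => heatK s z) y)
        (fun s y => deriv (fun z => heatK (-s) z) (-y)) t x
      = heatK t x + heatK (-t) (-x) := by
  simp only [stConv, deriv_heatK, ← heatK'.eq_1]
  rcases le_total 0 t with ht | ht
  · have h0 : heatK (-t) (-x) = 0 := by simp [heatK, ht]
    rw [h0, add_zero, ← two_mul_integral_heatK'_mul_heatK' ht h, ← integral_neg_eq_self]
    simp only [Prod.fst_neg, Prod.snd_neg, neg_neg, sub_neg_eq_add]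
  · have h0 : heatK t x = 0 := by simp [heatK, ht]
    have h' : (-t, -x) ≠ (0, 0) := by simpa using h
    rw [h0, zero_add, ← two_mul_integral_heatK'_mul_heatK' (neg_nonneg.2 ht) h',
      ← integral_sub_left_eq_self _ _ (t, x)]
    simp only [Prod.fst_sub, Prod.snd_sub, neg_sub, sub_sub_cancel]
    congr 2
    ext p
    rw [mul_comm, sub_eq_neg_add, sub_eq_neg_add]
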